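/- (Theorem 2, coarse-graining of outcomes) Let e be an empirical model on a measurement scenario (X, M, O') and let h : O' → O be a function between finite outcome sets. Define (e/h)_C(s) = Σ_{s' ∈ O'^C, h ∘ s' = s} e_C(s') for C ∈ M and s ∈ O^C. Then e/h is an empirical model on (X, M, O) and CF(e/h) ≤ CF(e). -/

import Mathlib

open Finset

/-- Assignments of outcomes in `O` to the measurements in a context `C`. -/
abbrev Assign {X : Type} (C : Finset X) (O : Type) : Type := {x // x ∈ C} → O

variable {X O : Type} [Fintype X] [DecidableEq X] [Fintype O] [DecidableEq O]

/-- Marginalisation of a distribution on assignments on `C` to a subset `U ⊆ C`. -/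
noncomputable def marg {C U : Finset X} (h : U ⊆ C) (d : Assign C O → ℝ) :
    Assign U O → ℝ :=
  fun t => ∑ s ∈ univ.filter
    (fun s : Assign C O => ∀ u : {x // x ∈ U}, s ⟨u.1, h u.2⟩ = t u), d s

/-- Marginalisation of a distribution on global assignments to a context `C`. -/
noncomputable def margG (C : Finset X) (d : (X → O) → ℝ) : Assign C O → ℝ :=
  fun t => ∑ g ∈ univ.filter (fun g : X → O => ∀ x : {x // x ∈ C}, g x.1 = t x), d g

/-- `d` is a probability distribution on the finite type `α`. -/
def IsProb {α : Type} [Fintype α] (d : α → ℝ) : Prop :=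
  (∀ a, 0 ≤ d a) ∧ ∑ a, d a = 1

/-- An empirical model on the scenario `(X, M, O)`: a probability distribution on each
context of `M`, compatible on overlaps. -/
def IsEmpiricalModel (M : Finset (Finset X)) (e : ∀ C : Finset X, Assign C O → ℝ) : Prop :=
  (∀ C ∈ M, IsProb (e C)) ∧
  ∀ C ∈ M, ∀ C' ∈ M,
    marg (inter_subset_left : C ∩ C' ⊆ C) (e C) =
    marg (inter_subset_right : C ∩ C' ⊆ C') (e C')

/-- A model is non-contextual if it is the marginalisation of a probability
distribution on global assignments. -/
def NonContextual (M : Finset (Finset X)) (e : ∀ C : Finset X, Assign C O → ℝ) : Prop :=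
  ∃ d : (X → O) → ℝ, IsProb d ∧ ∀ C ∈ M, margG C d = e C

/-- A model is strongly contextual if no global assignment is consistent with its support. -/
def StronglyContextual (M : Finset (Finset X)) (e : ∀ C : Finset X, Assign C O → ℝ) : Prop :=
  ¬ ∃ g : X → O, ∀ C ∈ M, 0 < e C (fun x => g x.1)

/-- `b` is a subprobability distribution on global assignments whose marginals are
  dominated by the empirical model `e`. -/
def Feasible (M : Finset (Finset X)) (e : ∀ C : Finset X, Assign C O → ℝ)
    (b : (X → O) → ℝ) : Prop :=
  (∀ g, 0 ≤ b g) ∧ (∑ g, b g) ≤ 1 ∧ ∀ C ∈ M, ∀ t, margG C b t ≤ e C t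

/-- The non-contextual fraction: the maximum weight of a subprobability distribution on
global assignments dominated by `e`. -/
noncomputable def NCF (M : Finset (Finset X)) (e : ∀ C : Finset X, Assign C O → ℝ) : ℝ :=
  sSup {w | ∃ b : (X → O) → ℝ, Feasible M e b ∧ ∑ g, b g = w}

/-- The contextual fraction. -/
noncomputable def CF (M : Finset (Finset X)) (e : ∀ C : Finset X, Assign C O → ℝ) : ℝ :=
  1 - NCF M e

/-- The coarse-graining `e/h` of an empirical model on `(X, M, O')` along a map of
outcomes `h : O' → O`. -/
noncomputable def coarseModel {X O' O : Type} [Fintype X] [DecidableEq X]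
    [Fintype O'] [DecidableEq O'] [Fintype O] [DecidableEq O]
    (e : ∀ C : Finset X, Assign C O' → ℝ) (h : O' → O) :
    ∀ C : Finset X, Assign C O → ℝ :=
  fun C s => ∑ s' ∈ univ.filter (fun s' : Assign C O' => h ∘ s' = s), e C s'

/-- The pushforward of a weight function along a map of finite types. -/
noncomputable def pushforward {α β : Type} [Fintype α] [DecidableEq β]
    (f : α → β) (d : α → ℝ) : β → ℝ :=
  fun b => ∑ a ∈ univ.filter (fun a => f a = b), d a

theorem pushforward_pushforward {α β γ : Type} [Fintype α] [Fintype β] [DecidableEq β]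
    [DecidableEq γ] (f : α → β) (g : β → γ) (d : α → ℝ) :
    pushforward g (pushforward f d) = pushforward (g ∘ f) d := by
  funext c
  simp only [pushforward, sum_filter (fun a => f a = _), Function.comp_apply]
  rw [sum_comm]
  simp [sum_filter]

theorem sum_pushforward {α β : Type} [Fintype α] [Fintype β] [DecidableEq β]
    (f : α → β) (d : α → ℝ) : ∑ b, pushforward f d b = ∑ a, d a :=
  sum_fiberwise univ f d

theorem pushforward_nonneg {α β : Type} [Fintype α] [DecidableEq β]
    (f : α → β) {d : α → ℝ} (hd : ∀ a, 0 ≤ d a) (b : β) : 0 ≤ pushforward f d b :=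
  sum_nonneg fun a _ => hd a

theorem pushforward_mono {α β : Type} [Fintype α] [DecidableEq β]
    (f : α → β) {d d' : α → ℝ} (hd : ∀ a, d a ≤ d' a) (b : β) :
    pushforward f d b ≤ pushforward f d' b :=
  sum_le_sum fun a _ => hd a

theorem IsProb.pushforward {α β : Type} [Fintype α] [Fintype β] [DecidableEq β]
    {d : α → ℝ} (hd : IsProb d) (f : α → β) : IsProb (pushforward f d) :=
  ⟨pushforward_nonneg f hd.1, (sum_pushforward f d).trans hd.2⟩

theorem marg_eq_pushforward {Y A : Type} [DecidableEq Y] [Fintype A] [DecidableEq A]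
    {C U : Finset Y} (hU : U ⊆ C) (d : Assign C A → ℝ) :
    marg hU d = pushforward (fun s (u : {x // x ∈ U}) => s ⟨u.1, hU u.2⟩) d := by
  funext t
  simp [marg, pushforward, funext_iff]

theorem margG_eq_pushforward {Y A : Type} [Fintype Y] [DecidableEq Y] [Fintype A]
    [DecidableEq A] (C : Finset Y) (d : (Y → A) → ℝ) :
    margG C d = pushforward (fun g (x : {x // x ∈ C}) => g x.1) d := by
  funext t
  simp [margG, pushforward, funext_iff]

theorem coarseModel_eq_pushforward {Y A B : Type} [Fintype Y] [DecidableEq Y]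
    [Fintype A] [DecidableEq A] [Fintype B] [DecidableEq B]
    (e : ∀ C : Finset Y, Assign C A → ℝ) (h : A → B) (C : Finset Y) :
    coarseModel e h C = pushforward (fun s => h ∘ s) (e C) :=
  rfl

/-- Marginalisation commutes with coarse-graining of outcomes. -/
theorem marg_coarseModel {Y A B : Type} [Fintype Y] [DecidableEq Y]
    [Fintype A] [DecidableEq A] [Fintype B] [DecidableEq B]
    (e : ∀ C : Finset Y, Assign C A → ℝ) (h : A → B) {C U : Finset Y} (hU : U ⊆ C) :
    marg hU (coarseModel e h C) = pushforward (fun s => h ∘ s) (marg hU (e C)) := by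
  rw [marg_eq_pushforward, marg_eq_pushforward, coarseModel_eq_pushforward,
    pushforward_pushforward, pushforward_pushforward]
  rfl

theorem IsEmpiricalModel.coarseModel {Y A B : Type} [Fintype Y] [DecidableEq Y]
    [Fintype A] [DecidableEq A] [Fintype B] [DecidableEq B] {M : Finset (Finset Y)}
    {e : ∀ C : Finset Y, Assign C A → ℝ} (he : IsEmpiricalModel M e) (h : A → B) :
    IsEmpiricalModel M (coarseModel e h) := by
  refine ⟨fun C hC => (he.1 C hC).pushforward _, fun C hC C' hC' => ?_⟩
  rw [marg_coarseModel, marg_coarseModel, he.2 C hC C' hC']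

theorem Feasible.pushforward {Y A B : Type} [Fintype Y] [DecidableEq Y]
    [Fintype A] [DecidableEq A] [Fintype B] [DecidableEq B] {M : Finset (Finset Y)}
    {e : ∀ C : Finset Y, Assign C A → ℝ} {b : (Y → A) → ℝ} (hb : Feasible M e b)
    (h : A → B) :
    Feasible M (coarseModel e h) (pushforward (fun g => h ∘ g) b) := by
  refine ⟨pushforward_nonneg _ hb.1, (sum_pushforward _ b).trans_le hb.2.1,
    fun C hC t => ?_⟩
  have key : margG C (_root_.pushforward (fun g => h ∘ g) b) =
      _root_.pushforward (fun s => h ∘ s) (margG C b) := by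
    rw [margG_eq_pushforward, margG_eq_pushforward, pushforward_pushforward,
      pushforward_pushforward]
    rfl
  rw [key]
  exact pushforward_mono _ (hb.2.2 C hC) t

theorem feasible_zero {Y A : Type} [Fintype Y] [DecidableEq Y] [Fintype A] [DecidableEq A]
    {M : Finset (Finset Y)} {e : ∀ C : Finset Y, Assign C A → ℝ}
    (he : IsEmpiricalModel M e) : Feasible M e 0 :=
  ⟨fun _ => le_rfl, by simp, fun C hC t => by simpa [margG] using (he.1 C hC).1 t⟩

theorem Feasible.sum_le_NCF {Y A : Type} [Fintype Y] [DecidableEq Y] [Fintype A]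
    [DecidableEq A] {M : Finset (Finset Y)} {e : ∀ C : Finset Y, Assign C A → ℝ}
    {b : (Y → A) → ℝ} (hb : Feasible M e b) : ∑ g, b g ≤ NCF M e :=
  le_csSup ⟨1, by rintro _ ⟨b', hb', rfl⟩; exact hb'.2.1⟩ ⟨b, hb, rfl⟩

/-- **Theorem 2, coarse-graining of outcomes.** Coarse-graining outcomes
yields an empirical model and does not increase the contextual fraction. -/
theorem contextual_fraction_monotone_coarse_graining
    {X O' O : Type} [Fintype X] [DecidableEq X]
    [Fintype O'] [DecidableEq O'] [Fintype O] [DecidableEq O]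
    (M : Finset (Finset X)) (e : ∀ C : Finset X, Assign C O' → ℝ)
    (he : IsEmpiricalModel M e) (h : O' → O) :
    IsEmpiricalModel M (coarseModel e h) ∧
    CF M (coarseModel e h) ≤ CF M e := by
  refine ⟨he.coarseModel h, sub_le_sub_left ?_ 1⟩
  refine csSup_le ⟨_, 0, feasible_zero he, rfl⟩ ?_
  rintro _ ⟨b, hb, rfl⟩
  exact (sum_pushforward _ b).symm.trans_le (hb.pushforward h).sum_le_NCF
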